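/- arXiv:2007.05730 — 3 statements merged into one kernel-verified Lean document; each statement's English description precedes it below -/
import Mathlib

section
/- Let (S,T,α,β) be a matched product system of left inverse semi-braces. Then S×T, equipped with (a,u)+(b,v) = (a+b, u+v) and (a,u)·(b,v) = (α_u(α_u⁻¹(a)·b), β_a(β_a⁻¹(u)·v)), is a left inverse semi-brace; in particular (S×T,·) is an inverse semigroup in which the inverse of (a,u) is (α_{β_a⁻¹(u)}⁻¹(a⁻¹), β_{α_u⁻¹(a)}⁻¹(u⁻¹)). -/
/-- An inverse semigroup: a semigroup in which every element `a` has a unique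
element `inv a` satisfying `a * inv a * a = a` and `inv a * a * inv a = inv a`. -/
structure InvSemigroup (S : Type*) where
  mul : S → S → S
  inv : S → S
  mul_assoc : ∀ a b c : S, mul (mul a b) c = mul a (mul b c)
  mul_inv_mul : ∀ a : S, mul (mul a (inv a)) a = a
  inv_mul_inv : ∀ a : S, mul (mul (inv a) a) (inv a) = inv a
  inv_unique : ∀ a x : S, mul (mul a x) a = a → mul (mul x a) x = x → x = inv a

/-- A left inverse semi-brace: `(S,+)` a semigroup, `(S,·)` an inverse semigroup,
with `a·(b+c) = a·b + a·(a⁻¹+c)`. -/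
structure LeftInvSemiBrace (S : Type*) extends InvSemigroup S where
  add : S → S → S
  add_assoc : ∀ a b c : S, add (add a b) c = add a (add b c)
  brace : ∀ a b c : S, mul a (add b c) = add (mul a b) (mul a (add (inv a) c))

/-- `λ_a(b) = a·(a⁻¹+b)`. -/
def LeftInvSemiBrace.lam {S : Type*} (B : LeftInvSemiBrace S) (a b : S) : S :=
  B.mul a (B.add (B.inv a) b)

/-- `ρ_b(a) = (a⁻¹+b)⁻¹·b`. -/
def LeftInvSemiBrace.rho {S : Type*} (B : LeftInvSemiBrace S) (b a : S) : S :=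
  B.mul (B.inv (B.add (B.inv a) b)) b

/-- The map associated to a left inverse semi-brace: `r(a,b) = (λ_a(b), ρ_b(a))`. -/
def LeftInvSemiBrace.rmap {S : Type*} (B : LeftInvSemiBrace S) : S × S → S × S :=
  fun p => (B.lam p.1 p.2, B.rho p.2 p.1)

/-- `r × id` on `S × S × S`. -/
def rOne {S : Type*} (r : S × S → S × S) : S × S × S → S × S × S :=
  fun p => ((r (p.1, p.2.1)).1, (r (p.1, p.2.1)).2, p.2.2)

/-- `id × r` on `S × S × S`. -/
def rTwo {S : Type*} (r : S × S → S × S) : S × S × S → S × S × S :=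
  fun p => (p.1, r p.2)

/-- `r` is a set-theoretical solution of the Yang-Baxter equation. -/
def IsYBE {S : Type*} (r : S × S → S × S) : Prop :=
  rOne r ∘ rTwo r ∘ rOne r = rTwo r ∘ rOne r ∘ rTwo r

/-- A matched product system of left inverse semi-braces. -/
structure MatchedSystem {S T : Type*} (BS : LeftInvSemiBrace S) (BT : LeftInvSemiBrace T) where
  α : T → S → S
  α' : T → S → S
  β : S → T → T
  β' : S → T → T
  α_left : ∀ (u : T) (a : S), α' u (α u a) = a
  α_right : ∀ (u : T) (a : S), α u (α' u a) = a
  β_left : ∀ (a : S) (u : T), β' a (β a u) = u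
  β_right : ∀ (a : S) (u : T), β a (β' a u) = u
  α_add : ∀ (u : T) (a b : S), α u (BS.add a b) = BS.add (α u a) (α u b)
  β_add : ∀ (a : S) (u v : T), β a (BT.add u v) = BT.add (β a u) (β a v)
  α_hom : ∀ (u v : T) (a : S), α (BT.mul u v) a = α u (α v a)
  β_hom : ∀ (a b : S) (u : T), β (BS.mul a b) u = β a (β b u)
  mps1 : ∀ (a b : S) (u : T), α u (BS.mul (α' u a) b) = BS.mul a (α (β' a u) b)
  mps2 : ∀ (a : S) (u v : T), β a (BT.mul (β' a u) v) = BT.mul u (β (α' u a) v)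
  mps_idem : ∀ (a : S) (u : T), α u (BS.mul (α' u a) a) = a →
    β a (BT.mul (β' a u) u) = u → α u a = a ∧ β a u = u

namespace InvSemigroup

variable {S : Type*} (B : InvSemigroup S)

theorem mul_inv_idem (a : S) :
    B.mul (B.mul a (B.inv a)) (B.mul a (B.inv a)) = B.mul a (B.inv a) := by
  rw [← B.mul_assoc, B.mul_inv_mul]

theorem mul_idem {e f : S} (he : B.mul e e = e) (hf : B.mul f f = f) :
    B.mul (B.mul e f) (B.mul e f) = B.mul e f := by
  have he' (y : S) : B.mul e (B.mul e y) = B.mul e y := by rw [← B.mul_assoc, he]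
  have hf' (y : S) : B.mul f (B.mul f y) = B.mul f y := by rw [← B.mul_assoc, hf]
  obtain ⟨x, hx⟩ : ∃ x, x = B.inv (B.mul e f) := ⟨_, rfl⟩
  have h₁ := B.mul_inv_mul (B.mul e f)
  have h₂ := B.inv_mul_inv (B.mul e f)
  rw [← hx] at h₁ h₂
  simp only [B.mul_assoc] at h₁ h₂
  have h₂' (y : S) : B.mul x (B.mul e (B.mul f (B.mul x y))) = B.mul x y := by
    simpa only [B.mul_assoc] using congrArg (B.mul · y) h₂
  have h₃ : B.mul f (B.mul x e) = x := by
    rw [hx]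
    refine B.inv_unique _ _ ?_ ?_ <;> rw [← hx]
    · simp only [B.mul_assoc, he', hf', h₁]
    · simp only [B.mul_assoc, he', hf', h₂']
  have h₄ : B.mul x x = x := by
    conv_lhs => rw [← h₃]
    simp only [B.mul_assoc, h₂']
    exact h₃
  have h₅ : B.mul e f = B.inv x := by
    apply B.inv_unique <;> simp only [B.mul_assoc, h₁, h₂]
  have h₆ : x = B.inv x := by
    apply B.inv_unique <;> simp only [h₄]
  rw [h₅, ← h₆, h₄]

theorem idem_comm {e f : S} (he : B.mul e e = e) (hf : B.mul f f = f) :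
    B.mul e f = B.mul f e := by
  have he' (y : S) : B.mul e (B.mul e y) = B.mul e y := by rw [← B.mul_assoc, he]
  have hf' (y : S) : B.mul f (B.mul f y) = B.mul f y := by rw [← B.mul_assoc, hf]
  have h₁ := B.mul_idem he hf
  have h₂ := B.mul_idem hf he
  have h₃ : B.mul e f = B.inv (B.mul e f) := by
    apply B.inv_unique <;> simp only [h₁]
  have h₄ : B.mul f e = B.inv (B.mul e f) := by
    simp only [B.mul_assoc] at h₁ h₂
    apply B.inv_unique <;> simp only [B.mul_assoc, he', hf', h₁, h₂]
  rw [h₃, ← h₄]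

end InvSemigroup

theorem inverse_unique_of_idem_comm {S : Type*} [Semigroup S]
    (h : ∀ e f : S, e * e = e → f * f = f → e * f = f * e) {a x y : S}
    (hx : a * x * a = a) (hx' : x * a * x = x) (hy : a * y * a = a) (hy' : y * a * y = y) :
    x = y := by
  have h₁ : (x * a) * (y * a) = (y * a) * (x * a) :=
    h _ _ (by rw [← mul_assoc, hx']) (by rw [← mul_assoc, hy'])
  have h₂ : (a * x) * (a * y) = (a * y) * (a * x) :=
    h _ _ (by rw [← mul_assoc, hx]) (by rw [← mul_assoc, hy])
  calc x = x * (a * y * a) * x := by rw [hy, hx']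
    _ = ((x * a) * (y * a)) * x := by simp only [mul_assoc]
    _ = y * (a * x * a) * x := by rw [h₁]; simp only [mul_assoc]
    _ = y * a * y * a * x := by rw [hx, hy']
    _ = y * ((a * y) * (a * x)) := by simp only [mul_assoc]
    _ = y * (a * x * a) * y := by rw [← h₂]; simp only [mul_assoc]
    _ = y := by rw [hx, hy']

namespace MatchedSystem

variable {S T : Type*} {BS : LeftInvSemiBrace S} {BT : LeftInvSemiBrace T}

/-- The matched product system with the roles of the two semi-braces exchanged. -/
def swap (M : MatchedSystem BS BT) : MatchedSystem BT BS where
  α := M.β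
  α' := M.β'
  β := M.α
  β' := M.α'
  α_left := M.β_left
  α_right := M.β_right
  β_left := M.α_left
  β_right := M.α_right
  α_add := M.β_add
  β_add := M.α_add
  α_hom := M.β_hom
  β_hom := M.α_hom
  mps1 a b u := M.mps2 u a b
  mps2 a u v := M.mps1 u v a
  mps_idem a u h₁ h₂ := (M.mps_idem u a h₂ h₁).symm

variable (M : MatchedSystem BS BT)

theorem α_inj {u : T} {a b : S} (h : M.α u a = M.α u b) : a = b := by
  rw [← M.α_left u a, h, M.α_left]

theorem α_idem {e : T} (he : BT.mul e e = e) (a : S) : M.α e a = a :=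
  M.α_inj (u := e) (by rw [← M.α_hom, he])

theorem α'_idem {e : T} (he : BT.mul e e = e) (a : S) : M.α' e a = a :=
  M.α_inj (u := e) (by rw [M.α_right, M.α_idem he])

theorem α_inv (u : T) (a : S) : M.α (BT.inv u) a = M.α' u a :=
  M.α_inj (u := u) (by rw [← M.α_hom, M.α_right, M.α_idem (BT.mul_inv_idem u)])

theorem α'_inv (u : T) (a : S) : M.α' (BT.inv u) a = M.α u a :=
  M.α_inj (u := BT.inv u) (by rw [M.α_right, M.α_inv, M.α_left])

theorem β'_idem {e : S} (he : BS.mul e e = e) (u : T) : M.β' e u = u :=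
  M.swap.α'_idem he u

theorem β'_inv (a : S) (u : T) : M.β' (BS.inv a) u = M.β a u :=
  M.swap.α'_inv a u

theorem α'_mul (a b : S) (u : T) :
    M.α' u (BS.mul a (M.α (M.β' a u) b)) = BS.mul (M.α' u a) b := by
  rw [← M.mps1, M.α_left]

theorem inv_α' (a : S) (u : T) : BS.inv (M.α' u a) = M.α' (M.β' a u) (BS.inv a) := by
  have h₁ : BS.mul (M.α' u a) (M.α' (M.β' a u) (BS.inv a)) = M.α' u (BS.mul a (BS.inv a)) := by
    rw [← M.α'_mul, M.α_right]
  have he := BS.mul_inv_idem a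
  symm
  apply BS.inv_unique
  · rw [h₁, ← M.α'_mul, M.β'_idem he, M.α_right, BS.mul_inv_mul]
  · rw [BS.mul_assoc, h₁, ← M.α'_mul, M.β'_inv, M.β_right, M.α_right, ← BS.mul_assoc, BS.inv_mul_inv]

theorem α'_inv_β'_inv (a : S) (u : T) :
    M.α' (BT.inv (M.β' a u)) (BS.inv (M.α' u a)) = BS.inv a := by
  rw [M.inv_α', M.α'_inv, M.α_right]

theorem β'_inv_α'_inv (a : S) (u : T) :
    M.β' (BS.inv (M.α' u a)) (BT.inv (M.β' a u)) = BT.inv u :=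
  M.swap.α'_inv_β'_inv u a

theorem α_inv_β'_mul (a : S) (u : T) (b : S) :
    M.α (BT.inv (M.β' a u)) (BS.mul (BS.inv a) b) =
      BS.mul (BS.inv (M.α' u a)) (M.α' u b) := by
  rw [← M.α'_inv_β'_inv a u, M.mps1, M.β'_inv_α'_inv, M.α_inv]

/-- The multiplication of the matched product. -/
def prodMul (p q : S × T) : S × T :=
  (M.α p.2 (BS.mul (M.α' p.2 p.1) q.1), M.β p.1 (BT.mul (M.β' p.1 p.2) q.2))

/-- The inversion of the matched product. -/
def prodInv (p : S × T) : S × T :=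
  (BS.inv (M.α' p.2 p.1), BT.inv (M.β' p.1 p.2))

theorem prodMul_assoc_fst (p q r : S × T) :
    (M.prodMul (M.prodMul p q) r).1 = (M.prodMul p (M.prodMul q r)).1 := by
  obtain ⟨a, u⟩ := p
  obtain ⟨b, v⟩ := q
  obtain ⟨d, z⟩ := r
  have h (y : S) : M.α (M.β a (BT.mul (M.β' a u) v)) y =
      M.α u (M.α (M.β (M.α' u a) v) y) := by rw [M.mps2, M.α_hom]
  have hw : M.α' (M.β a (BT.mul (M.β' a u) v)) (M.α u (BS.mul (M.α' u a) b)) =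
      BS.mul (M.α' (M.β (M.α' u a) v) (M.α' u a)) (M.α' v b) := by
    apply M.α_inj (u := M.β a (BT.mul (M.β' a u) v))
    rw [M.α_right, h, M.mps1 (M.α' u a), M.β_left, M.α_right]
  change M.α (M.β a (BT.mul (M.β' a u) v))
      (BS.mul (M.α' (M.β a (BT.mul (M.β' a u) v)) (M.α u (BS.mul (M.α' u a) b))) d) =
    M.α u (BS.mul (M.α' u a) (M.α v (BS.mul (M.α' v b) d)))
  rw [hw, h, BS.mul_assoc, M.mps1, M.β_left]

theorem prodMul_assoc (p q r : S × T) :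
    M.prodMul (M.prodMul p q) r = M.prodMul p (M.prodMul q r) :=
  Prod.ext (M.prodMul_assoc_fst p q r) (M.swap.prodMul_assoc_fst p.swap q.swap r.swap)

theorem prodMul_prodInv_prodMul_fst (p : S × T) :
    (M.prodMul p (M.prodMul (M.prodInv p) p)).1 = p.1 := by
  obtain ⟨a, u⟩ := p
  simp only [prodMul, prodInv]
  rw [M.α'_inv_β'_inv, M.α_inv_β'_mul, ← BS.mul_assoc, BS.mul_inv_mul, M.α_right]

theorem prodInv_prodMul_prodInv_fst (p : S × T) :
    (M.prodMul (M.prodInv p) (M.prodMul p (M.prodInv p))).1 = (M.prodInv p).1 := by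
  obtain ⟨a, u⟩ := p
  simp only [prodMul, prodInv]
  rw [M.α'_inv_β'_inv, M.α_inv_β'_mul, M.α_left, ← BS.mul_assoc, BS.inv_mul_inv]

theorem idem_of_prodMul_self {p : S × T} (h : M.prodMul p p = p) :
    BS.mul p.1 p.1 = p.1 ∧ BT.mul p.2 p.2 = p.2 := by
  obtain ⟨a, u⟩ := p
  obtain ⟨h₁, h₂⟩ := Prod.ext_iff.1 h
  simp only [prodMul] at h₁ h₂ ⊢
  obtain ⟨ha, hu⟩ := M.mps_idem a u h₁ h₂
  have ha' : M.α' u a = a := by conv_lhs => rw [← ha, M.α_left]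
  have hu' : M.β' a u = u := by conv_lhs => rw [← hu, M.β_left]
  rw [ha'] at h₁
  rw [hu'] at h₂
  exact ⟨M.α_inj (h₁.trans ha.symm), M.swap.α_inj (h₂.trans hu.symm)⟩

theorem prodMul_of_idem {p : S × T} (hS : BS.mul p.1 p.1 = p.1) (hT : BT.mul p.2 p.2 = p.2)
    (q : S × T) : M.prodMul p q = (BS.mul p.1 q.1, BT.mul p.2 q.2) :=
  Prod.ext ((M.α_idem hT _).trans (by rw [M.α'_idem hT]))
    ((M.swap.α_idem hS _).trans (congrArg (BT.mul · q.2) (M.swap.α'_idem hS p.2)))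

theorem prodMul_idem_comm {p q : S × T} (hp : M.prodMul p p = p) (hq : M.prodMul q q = q) :
    M.prodMul p q = M.prodMul q p := by
  obtain ⟨hp₁, hp₂⟩ := M.idem_of_prodMul_self hp
  obtain ⟨hq₁, hq₂⟩ := M.idem_of_prodMul_self hq
  rw [M.prodMul_of_idem hp₁ hp₂, M.prodMul_of_idem hq₁ hq₂, BS.idem_comm hp₁ hq₁,
    BT.idem_comm hp₂ hq₂]

/-- The multiplicative inverse semigroup of the matched product. -/
def prodInvSemigroup : InvSemigroup (S × T) where
  mul := M.prodMul
  inv := M.prodInv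
  mul_assoc := M.prodMul_assoc
  mul_inv_mul p := by
    rw [M.prodMul_assoc]
    exact Prod.ext (M.prodMul_prodInv_prodMul_fst p) (M.swap.prodMul_prodInv_prodMul_fst p.swap)
  inv_mul_inv p := by
    rw [M.prodMul_assoc]
    exact Prod.ext (M.prodInv_prodMul_prodInv_fst p) (M.swap.prodInv_prodMul_prodInv_fst p.swap)
  inv_unique p x h₁ h₂ := by
    let _ : Semigroup (S × T) := { mul := M.prodMul, mul_assoc := M.prodMul_assoc }
    refine inverse_unique_of_idem_comm (fun e f => M.prodMul_idem_comm) h₁ h₂ ?_ ?_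
    · refine (M.prodMul_assoc _ _ _).trans ?_
      exact Prod.ext (M.prodMul_prodInv_prodMul_fst p)
        (M.swap.prodMul_prodInv_prodMul_fst p.swap)
    · refine (M.prodMul_assoc _ _ _).trans ?_
      exact Prod.ext (M.prodInv_prodMul_prodInv_fst p)
        (M.swap.prodInv_prodMul_prodInv_fst p.swap)

/-- The matched product of a matched product system. -/
def prod : LeftInvSemiBrace (S × T) where
  toInvSemigroup := M.prodInvSemigroup
  add p q := (BS.add p.1 q.1, BT.add p.2 q.2)
  add_assoc p q r := by rw [BS.add_assoc, BT.add_assoc]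
  brace p q r := by
    simp only [prodInvSemigroup, prodMul, prodInv]
    rw [BS.brace, M.α_add, BT.brace, M.β_add]

end MatchedSystem

/-- The matched product of a matched product system of left inverse semi-braces is a
left inverse semi-brace, with the indicated inverse in the multiplicative semigroup. -/
theorem stmt_5 {S T : Type*} {BS : LeftInvSemiBrace S} {BT : LeftInvSemiBrace T}
    (M : MatchedSystem BS BT) :
    ∃ B : LeftInvSemiBrace (S × T),
      (∀ p q : S × T, B.add p q = (BS.add p.1 q.1, BT.add p.2 q.2)) ∧
      (∀ p q : S × T, B.mul p q =
        (M.α p.2 (BS.mul (M.α' p.2 p.1) q.1), M.β p.1 (BT.mul (M.β' p.1 p.2) q.2))) ∧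
      (∀ p : S × T, B.inv p =
        (M.α' (M.β' p.1 p.2) (BS.inv p.1), M.β' (M.α' p.2 p.1) (BT.inv p.2))) := by
  exact ⟨M.prod, fun _ _ => rfl, fun _ _ => rfl,
    fun p => Prod.ext (M.inv_α' p.1 p.2) (M.swap.inv_α' p.2 p.1)⟩
end

section
/- Let S and T be left semi-braces whose associated maps r_S and r_T are set-theoretical solutions of the Yang-Baxter equation, and let B be the double semidirect product of S and T via σ and δ. If, in addition, (u^{1_S})^a = u^a and (1_T)^a + u = 1_T + u hold for all a ∈ S and u ∈ T, where 1_S and 1_T are the identities of the groups (S,·) and (T,·), then the map r_B associated to B is a set-theoretical solution of the Yang-Baxter equation. -/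
/-- A left semi-brace: `(S,+)` a semigroup, `(S,·)` a group,
with `a·(b+c) = a·b + a·(a⁻¹+c)`. -/
structure LeftSemiBrace (S : Type*) where
  add : S → S → S
  mul : S → S → S
  one : S
  inv : S → S
  add_assoc : ∀ a b c : S, add (add a b) c = add a (add b c)
  mul_assoc : ∀ a b c : S, mul (mul a b) c = mul a (mul b c)
  one_mul : ∀ a : S, mul one a = a
  mul_one : ∀ a : S, mul a one = a
  mul_inv : ∀ a : S, mul a (inv a) = one
  inv_mul : ∀ a : S, mul (inv a) a = one
  brace : ∀ a b c : S, mul a (add b c) = add (mul a b) (mul a (add (inv a) c))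

/-- `λ_a(b) = a·(a⁻¹+b)`. -/
def LeftSemiBrace.lam {S : Type*} (B : LeftSemiBrace S) (a b : S) : S :=
  B.mul a (B.add (B.inv a) b)

/-- `ρ_b(a) = (a⁻¹+b)⁻¹·b`. -/
def LeftSemiBrace.rho {S : Type*} (B : LeftSemiBrace S) (b a : S) : S :=
  B.mul (B.inv (B.add (B.inv a) b)) b

/-- The map associated to a left semi-brace: `r(a,b) = (λ_a(b), ρ_b(a))`. -/
def LeftSemiBrace.rmap {S : Type*} (B : LeftSemiBrace S) : S × S → S × S :=
  fun p => (B.lam p.1 p.2, B.rho p.2 p.1)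

namespace LeftSemiBrace

variable {S : Type*} (B : LeftSemiBrace S)

theorem inv_mul_cancel_left (a b : S) : B.mul (B.inv a) (B.mul a b) = b := by
  rw [← B.mul_assoc, B.inv_mul, B.one_mul]

theorem mul_inv_cancel_left (a b : S) : B.mul a (B.mul (B.inv a) b) = b := by
  rw [← B.mul_assoc, B.mul_inv, B.one_mul]

theorem mul_left_cancel {a b c : S} (h : B.mul a b = B.mul a c) : b = c := by
  rw [← B.inv_mul_cancel_left a b, h, B.inv_mul_cancel_left]

theorem mul_right_cancel {a b c : S} (h : B.mul b a = B.mul c a) : b = c := by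
  rw [← B.mul_one b, ← B.mul_inv a, ← B.mul_assoc, h, B.mul_assoc, B.mul_inv, B.mul_one]

theorem eq_inv_of_mul_eq_one {a b : S} (h : B.mul a b = B.one) : b = B.inv a :=
  B.mul_left_cancel (a := a) (by rw [h, B.mul_inv])

theorem inv_inv (a : S) : B.inv (B.inv a) = a :=
  (B.eq_inv_of_mul_eq_one (B.inv_mul a)).symm

theorem inv_one : B.inv B.one = B.one :=
  (B.eq_inv_of_mul_eq_one (B.one_mul _)).symm

theorem inv_mul_rev (a b : S) : B.inv (B.mul a b) = B.mul (B.inv b) (B.inv a) :=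
  (B.eq_inv_of_mul_eq_one (by rw [B.mul_assoc, B.mul_inv_cancel_left, B.mul_inv])).symm

theorem inv_injective {a b : S} (h : B.inv a = B.inv b) : a = b := by
  rw [← B.inv_inv a, h, B.inv_inv]

theorem mul_add (a b c : S) : B.mul a (B.add b c) = B.add (B.mul a b) (B.lam a c) :=
  B.brace a b c

theorem mul_one_add (a b : S) : B.mul a (B.add B.one b) = B.add a (B.lam a b) := by
  rw [B.mul_add, B.mul_one]

theorem lam_one (b : S) : B.lam B.one b = B.add B.one b := by
  rw [lam, B.inv_one, B.one_mul]

theorem lam_add (a b c : S) : B.lam a (B.add b c) = B.add (B.lam a b) (B.lam a c) := by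
  rw [lam, ← B.add_assoc, B.mul_add]; rfl

theorem lam_lam (a b c : S) : B.lam a (B.lam b c) = B.lam (B.mul a b) c := by
  rw [lam.eq_1 B (B.mul a b), B.inv_mul_rev, B.mul_assoc, B.mul_add, B.mul_inv_cancel_left]; rfl

theorem lam_inv_lam (a b : S) : B.lam (B.inv a) (B.lam a b) = B.add B.one b := by
  rw [B.lam_lam, B.inv_mul, B.lam_one]

theorem lam_lam_inv (a b : S) : B.lam a (B.lam (B.inv a) b) = B.add B.one b := by
  rw [B.lam_lam, B.mul_inv, B.lam_one]

theorem add_one_add (a b : S) : B.add a (B.add B.one b) = B.add a b := by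
  rw [← B.lam_one, ← B.one_mul (B.add a b), B.mul_add, B.one_mul]

theorem one_add_lam (a b : S) : B.add B.one (B.lam a b) = B.lam a b := by
  rw [← B.lam_one, B.lam_lam, B.one_mul]

theorem one_add_one : B.add B.one B.one = B.one := by
  have h : B.lam (B.inv (B.add B.one B.one)) B.one = B.one := by
    rw [lam, B.inv_inv, B.add_assoc, B.add_one_add, B.inv_mul]
  have h1 := B.one_add_lam (B.inv (B.add B.one B.one)) B.one
  rwa [h] at h1

theorem lam_mul_rho (a b : S) : B.mul (B.lam a b) (B.rho b a) = B.mul a b := by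
  rw [lam, rho, B.mul_assoc, B.mul_inv_cancel_left]

theorem rho_eq (a b : S) : B.rho b a = B.mul (B.inv (B.lam a b)) (B.mul a b) := by
  rw [← B.lam_mul_rho a, B.inv_mul_cancel_left]

theorem rho_rho (a b c : S) : B.rho c (B.rho b a) =
    B.mul (B.inv (B.add (B.inv a) (B.mul b (B.add B.one c)))) (B.mul b c) := by
  have h : B.add (B.inv a) (B.mul b (B.add B.one c)) =
      B.mul b (B.add (B.inv (B.rho b a)) c) := by
    rw [rho, B.inv_mul_rev, B.inv_inv, B.mul_one_add, B.mul_add, B.mul_inv_cancel_left,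
      B.add_assoc]
  rw [h, B.inv_mul_rev, B.mul_assoc, B.inv_mul_cancel_left]; rfl

/-- The map associated to a left semi-brace is a solution exactly when the sums
`a + b(1 + c)` are invariant under replacing `(b, c)` by `r(b, c)`. -/
theorem isYBE_iff : IsYBE B.rmap ↔ ∀ a b c : S,
    B.add a (B.mul b (B.add B.one c)) =
      B.add a (B.mul (B.lam b c) (B.add B.one (B.rho c b))) := by
  constructor
  · intro h a b c
    have h3 : B.rho c (B.rho b (B.inv a)) = B.rho (B.rho c b) (B.rho (B.lam b c) (B.inv a)) :=
      congrArg (fun p => p.2.2) (congrFun h (B.inv a, b, c))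
    rw [B.rho_rho, B.rho_rho, B.lam_mul_rho, B.inv_inv] at h3
    exact B.inv_injective (B.mul_right_cancel h3)
  · intro h
    funext ⟨a, b, c⟩
    have h1 : B.lam (B.lam a b) (B.lam (B.rho b a) c) = B.lam a (B.lam b c) := by
      rw [B.lam_lam, B.lam_mul_rho, B.lam_lam]
    have h3 : B.rho c (B.rho b a) = B.rho (B.rho c b) (B.rho (B.lam b c) a) := by
      rw [B.rho_rho, B.rho_rho, B.lam_mul_rho, h]
    have h2 : B.rho (B.lam (B.rho b a) c) (B.lam a b) =
        B.lam (B.rho (B.lam b c) a) (B.rho c b) := by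
      apply B.mul_right_cancel (a := B.rho c (B.rho b a))
      apply B.mul_left_cancel (a := B.lam a (B.lam b c))
      conv_rhs => rw [h3, B.lam_mul_rho, ← B.mul_assoc, B.lam_mul_rho, B.mul_assoc, B.lam_mul_rho]
      rw [← h1, ← B.mul_assoc, B.lam_mul_rho, B.mul_assoc, B.lam_mul_rho, ← B.mul_assoc,
        B.lam_mul_rho, B.mul_assoc]
    exact Prod.ext h1 (Prod.ext h2 h3)

variable {B}

theorem mul_lam_one_add_rho (h : IsYBE B.rmap) (b c : S) :
    B.mul (B.lam b c) (B.add B.one (B.rho c b)) =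
      B.add B.one (B.mul b (B.add B.one c)) := by
  rw [B.isYBE_iff.1 h, B.mul_one_add, ← B.add_assoc, B.one_add_lam]

theorem lam_eq_of_one_add_eq {k : S} (hk : B.add B.one k = B.one) (c : S) :
    B.lam k c = B.add B.one (B.mul k (B.add B.one c)) := by
  rw [B.mul_one_add, ← B.add_assoc, hk, B.one_add_lam]

theorem one_add_inv_eq_one (h : IsYBE B.rmap) {k : S} (hk : B.add B.one k = B.one) :
    B.add B.one (B.inv k) = B.one := by
  have hr : B.add B.one (B.inv (B.lam k (B.inv k))) = B.one := by
    have h1 := mul_lam_one_add_rho h k (B.inv k)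
    rw [← lam_eq_of_one_add_eq hk, B.rho_eq, B.mul_inv, B.mul_one] at h1
    exact B.mul_left_cancel (h1.trans (B.mul_one _).symm)
  have hr1 : B.lam k (B.inv k) = B.one := by
    have h1 : B.lam (B.inv (B.lam k (B.inv k))) (B.lam k (B.inv k)) =
        B.lam (B.inv (B.lam k (B.inv k))) B.one := by
      rw [lam_eq_of_one_add_eq hr, lam_eq_of_one_add_eq hr, B.one_add_lam, B.inv_mul,
        B.one_add_one, B.mul_one, hr]
    have h2 := congrArg (B.lam (B.lam k (B.inv k))) h1
    rwa [B.lam_lam_inv, B.lam_lam_inv, B.one_add_lam, B.one_add_one] at h2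
  have hk1 : B.lam k B.one = B.one := by
    rw [lam_eq_of_one_add_eq hk, B.one_add_one, B.mul_one, hk]
  rw [← B.lam_inv_lam k, hr1, ← hk1, B.lam_inv_lam, hk1, B.one_add_one]

/-- When the associated map is a solution, `λ_b(b⁻¹)` is an additive right inverse of `b`. -/
theorem one_add_add_lam_inv (h : IsYBE B.rmap) (b : S) :
    B.add B.one (B.add b (B.lam b (B.inv b))) = B.one := by
  have h1 := mul_lam_one_add_rho h B.one (B.inv b)
  rw [B.one_mul, B.add_one_add, B.rho_eq, B.lam_one, B.one_mul] at h1
  have h2 := one_add_inv_eq_one h (B.mul_left_cancel (h1.trans (B.mul_one _).symm))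
  rwa [B.inv_mul_rev, B.inv_inv, B.inv_inv, B.mul_one_add] at h2

theorem add_lam_inv_add_add (h : IsYBE B.rmap) (a c y : S) :
    B.add a (B.add (B.lam c (B.inv c)) (B.add c y)) = B.add a y := by
  have h1 : B.add (B.mul (B.inv c) a) (B.add (B.inv c)
      (B.add (B.lam (B.inv c) c) (B.lam (B.inv c) y))) =
      B.add (B.mul (B.inv c) a) (B.lam (B.inv c) y) := by
    have h2 := one_add_add_lam_inv h (B.inv c)
    rw [B.inv_inv] at h2
    rw [← B.add_one_add, ← B.add_assoc (B.inv c), ← B.add_assoc B.one, h2, B.one_add_lam]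
  have h3 := congrArg (B.mul c) h1
  rw [B.mul_add, B.mul_inv_cancel_left, B.lam_add, ← B.lam_add (B.inv c), B.lam_lam_inv,
    B.add_one_add, B.mul_add, B.mul_inv_cancel_left, B.lam_lam_inv, B.add_one_add] at h3
  exact h3

/-- If additive maps `f`, `g` satisfy the compatibility condition of a double semidirect product
at `u`, then a translate of the sum `u(1 + v)` by the range of `f` does not change when `u` and `v`
are replaced by `w = u(g(u⁻¹) + v)` and `w⁻¹uv`. -/
theorem add_mul_one_add_eq (h : IsYBE B.rmap) (f g : S → S)
    (hf : ∀ x y, f (B.add x y) = B.add (f x) (f y))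
    (hg : ∀ x y, g (B.add x y) = B.add (g x) (g y))
    (hg1 : ∀ x, B.add (g B.one) x = B.add B.one x) (u : S)
    (hfg : ∀ v w, B.add (f (B.mul u v)) (B.mul u (B.add (g (B.inv u)) w)) =
      B.mul u (B.add (g v) w)) (z v : S) :
    B.add (f z) (B.mul u (B.add B.one v)) =
      B.add (f z) (B.mul (B.mul u (B.add (g (B.inv u)) v)) (B.add B.one
        (B.mul (B.inv (B.mul u (B.add (g (B.inv u)) v))) (B.mul u v)))) := by
  have hleft : B.add (f z) (B.mul u (B.add B.one v)) =
      B.mul u (B.add (g (B.mul (B.inv u) z)) (B.add (g (B.lam (B.inv u) u)) v)) := by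
    rw [← hg1, ← hfg, B.mul_one, ← B.add_assoc, ← hf, ← B.mul_inv_cancel_left u (B.add z u),
      hfg, B.mul_add (B.inv u), hg, B.add_assoc]
  have hginv : ∀ x y, B.add x (B.add (g (B.inv u)) (B.add (g (B.lam (B.inv u) u)) y)) =
      B.add x y := by
    intro x y
    have h1 := one_add_add_lam_inv h (B.inv u)
    rw [B.inv_inv] at h1
    have h2 := congrArg (fun s => B.add (g s) y) h1
    simp only [hg, B.add_assoc] at h2
    rw [hg1, hg1] at h2
    rw [← B.add_one_add x, h2, B.add_one_add]
  generalize hp : g (B.inv u) = p at *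
  have hw : B.mul (B.mul u (B.add p v)) (B.add B.one
      (B.mul (B.inv (B.mul u (B.add p v))) (B.mul u v))) =
      B.mul u (B.add p (B.add (B.lam p (B.inv p)) v)) := by
    have h1 : B.mul u (B.add p v) = B.mul (B.mul u p) (B.lam (B.inv p) v) := by
      rw [lam, B.inv_inv, B.mul_assoc, B.mul_inv_cancel_left]
    have h2 : B.mul (B.inv (B.mul u (B.add p v))) (B.mul u v) = B.rho v (B.inv p) := by
      rw [h1, B.rho_eq, B.inv_mul_rev, B.inv_mul_rev]
      simp only [B.mul_assoc, B.inv_mul_cancel_left]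
    rw [h2, h1, B.mul_assoc (B.mul u p), mul_lam_one_add_rho h, B.mul_assoc u p, B.mul_one_add p,
      B.mul_one_add, B.lam_add, B.lam_lam_inv, B.add_one_add]
  rw [hw, ← B.mul_inv_cancel_left u z, hfg, B.mul_inv_cancel_left, hleft,
    ← hginv (B.lam p (B.inv p)) v, add_lam_inv_add_add h]

end LeftSemiBrace

/-- Sufficient conditions for the map associated to the double semidirect product of
two left semi-braces having solutions to be a solution. -/
theorem stmt_14 {S T : Type*} (BS : LeftSemiBrace S) (BT : LeftSemiBrace T)
    (σ : T → S → S)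
    (hbij : ∀ u : T, Function.Bijective (σ u))
    (hσadd : ∀ (u : T) (a b : S), σ u (BS.add a b) = BS.add (σ u a) (σ u b))
    (hσmul : ∀ (u : T) (a b : S), σ u (BS.mul a b) = BS.mul (σ u a) (σ u b))
    (hσhom : ∀ (u v : T) (a : S), σ (BT.mul u v) a = σ u (σ v a))
    (δ : S → T → T)
    (hδadd : ∀ (a : S) (u v : T), δ a (BT.add u v) = BT.add (δ a u) (δ a v))
    (hδanti : ∀ (a b : S) (u : T), δ (BS.add a b) u = δ b (δ a u))
    (hcomp : ∀ (a b : S) (u v w : T),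
      BT.add (δ (BS.lam a (σ u b)) (BT.mul u v))
          (BT.mul u (BT.add (δ b (BT.inv u)) w)) =
        BT.mul u (BT.add (δ b v) w))
    (hS : IsYBE BS.rmap) (hT : IsYBE BT.rmap)
    (hcond1 : ∀ (a : S) (u : T), δ a (δ BS.one u) = δ a u)
    (hcond2 : ∀ (a : S) (u : T), BT.add (δ a BT.one) u = BT.add BT.one u)
    (B : LeftSemiBrace (S × T))
    (hadd : ∀ p q : S × T, B.add p q = (BS.add p.1 q.1, BT.add (δ q.1 p.2) q.2))
    (hmul : ∀ p q : S × T, B.mul p q = (BS.mul p.1 (σ p.2 q.1), BT.mul p.2 q.2)) :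
    IsYBE B.rmap := by
  have hσone : ∀ a : S, σ BT.one a = a := fun a =>
    (hbij BT.one).1 (by rw [← hσhom, BT.one_mul])
  have hσS : ∀ u : T, σ u BS.one = BS.one := fun u =>
    BS.mul_left_cancel (a := σ u BS.one) (by rw [← hσmul, BS.one_mul, BS.mul_one])
  have hone : B.one = (BS.one, BT.one) := by
    rw [← B.mul_one (BS.one, BT.one), hmul]
    simp only [hσone, BS.one_mul, BT.one_mul]
  have hinv : ∀ (a : S) (u : T),
      σ u (B.inv (a, u)).1 = BS.inv a ∧ (B.inv (a, u)).2 = BT.inv u := by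
    intro a u
    have h := B.mul_inv (a, u)
    rw [hmul, hone] at h
    exact ⟨BS.eq_inv_of_mul_eq_one (congrArg Prod.fst h),
      BT.eq_inv_of_mul_eq_one (congrArg Prod.snd h)⟩
  have hlam : ∀ (a b : S) (u v : T),
      B.lam (a, u) (b, v) = (BS.lam a (σ u b), BT.mul u (BT.add (δ b (BT.inv u)) v)) := by
    intro a b u v
    rw [LeftSemiBrace.lam, hadd, hmul]
    simp only [hσadd, hinv, LeftSemiBrace.lam]
  have hmulone : ∀ (a b : S) (u v : T), B.mul (a, u) (B.add B.one (b, v)) =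
      (BS.mul a (BS.add BS.one (σ u b)), BT.mul u (BT.add BT.one v)) := by
    intro a b u v
    rw [hadd, hmul, hone]
    simp only [hσadd, hσS, hcond2]
  have hδ : ∀ (a : S) (u : T), δ (BS.add BS.one a) u = δ a u := by
    intro a u
    rw [hδanti, hcond1]
  rw [B.isYBE_iff]
  rintro ⟨x, t⟩ ⟨a, u⟩ ⟨b, v⟩
  have hr := B.lam_mul_rho (a, u) (b, v)
  rw [hmul, hmul, hlam] at hr
  have hr1 : σ (BT.mul u (BT.add (δ b (BT.inv u)) v)) (B.rho (b, v) (a, u)).1 =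
      BS.rho (σ u b) a := by
    rw [BS.rho_eq, ← show _ = BS.mul a (σ u b) from congrArg Prod.fst hr, BS.inv_mul_cancel_left]
  have hr2 : (B.rho (b, v) (a, u)).2 =
      BT.mul (BT.inv (BT.mul u (BT.add (δ b (BT.inv u)) v))) (BT.mul u v) := by
    rw [← show _ = BT.mul u v from congrArg Prod.snd hr, BT.inv_mul_cancel_left]
  rw [hlam, ← Prod.mk.eta (p := B.rho (b, v) (a, u)), hmulone, hmulone, hadd, hadd, hr1, hr2]
  refine Prod.ext (BS.isYBE_iff.1 hS _ _ _) ?_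
  have hY : ∀ z : T, δ (BS.mul (BS.lam a (σ u b)) (BS.add BS.one (BS.rho (σ u b) a))) z =
      δ (BS.mul a (BS.add BS.one (σ u b))) z := by
    intro z
    rw [LeftSemiBrace.mul_lam_one_add_rho hS, hδ]
  simp only [hY]
  rw [BS.mul_one_add, hδanti]
  exact LeftSemiBrace.add_mul_one_add_eq hT (δ (BS.lam a (σ u b))) (δ b) (hδadd _) (hδadd _)
    (hcond2 _) u (hcomp a b u) _ v
end

section
/- Let S and T be left inverse semi-braces and B the asymmetric product of S and T via σ, δ and 𝔟 (so B = S×T with (a,u)+(b,v) = (a+b, 𝔟(a,b)+u^b+v) and (a,u)·(b,v) = (a·(^u b), u·v)). Then the map r_B associated to B satisfies, for all (a,u),(b,v) ∈ S×T: r_B((a,u),(b,v)) = ((λ_a(^u b), u·(𝔟(^{u⁻¹}(a⁻¹), b) + (u⁻¹)^b + v)), (^{(𝔟(^{u⁻¹}(a⁻¹), b) + (u⁻¹)^b + v)⁻¹·u⁻¹}(ρ_{^u b}(a)), (𝔟(^{u⁻¹}(a⁻¹), b) + (u⁻¹)^b + v)⁻¹·v)). -/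
/-- A multiplicative map between inverse semigroups preserves inverses. -/
theorem InvSemigroup.map_inv {S T : Type*} (A : InvSemigroup S) (B : InvSemigroup T) (f : S → T)
    (hf : ∀ a b, f (A.mul a b) = B.mul (f a) (f b)) (a : S) : f (A.inv a) = B.inv (f a) := by
  apply B.inv_unique
  · rw [← hf, ← hf, A.mul_inv_mul]
  · rw [← hf, ← hf, A.inv_mul_inv]

/-- An action of an inverse semigroup by injective maps sends `u · u⁻¹` to the identity. -/
theorem InvSemigroup.act_act_inv {S T : Type*} (A : InvSemigroup T) (σ : T → S → S)
    (hinj : ∀ u, Function.Injective (σ u))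
    (hhom : ∀ u v a, σ (A.mul u v) a = σ u (σ v a)) (u : T) (a : S) :
    σ u (σ (A.inv u) a) = a := by
  apply hinj (A.inv u)
  rw [← hhom, ← hhom, A.inv_mul_inv]

/-- An action of an inverse semigroup by injective maps sends `u⁻¹ · u` to the identity. -/
theorem InvSemigroup.act_inv_act {S T : Type*} (A : InvSemigroup T) (σ : T → S → S)
    (hinj : ∀ u, Function.Injective (σ u))
    (hhom : ∀ u v a, σ (A.mul u v) a = σ u (σ v a)) (u : T) (a : S) :
    σ (A.inv u) (σ u a) = a := by
  apply hinj u
  rw [← hhom, ← hhom, A.mul_inv_mul]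

/-- The inverse of `(a, u)` in a semidirect product of inverse semigroups. -/
theorem InvSemigroup.inv_semidirect {S T : Type*} (A : InvSemigroup S) (A' : InvSemigroup T)
    (σ : T → S → S) (hinj : ∀ u, Function.Injective (σ u))
    (hhom : ∀ u v a, σ (A'.mul u v) a = σ u (σ v a))
    (hmap : ∀ u a b, σ u (A.mul a b) = A.mul (σ u a) (σ u b))
    (C : InvSemigroup (S × T))
    (hmul : ∀ p q : S × T, C.mul p q = (A.mul p.1 (σ p.2 q.1), A'.mul p.2 q.2)) (a : S) (u : T) :
    C.inv (a, u) = (σ (A'.inv u) (A.inv a), A'.inv u) := by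
  symm
  apply C.inv_unique
  · simp only [hmul, hhom, A'.act_act_inv σ hinj hhom, A.mul_inv_mul, A'.mul_inv_mul]
  · simp only [hmul, hhom, A'.act_inv_act σ hinj hhom, ← hmap, A.inv_mul_inv, A'.inv_mul_inv]

/-- The map associated to the asymmetric product of two left inverse semi-braces is
given by the indicated formula. -/
theorem stmt_16 {S T : Type*} (BS : LeftInvSemiBrace S) (BT : LeftInvSemiBrace T)
    (σ : T → S → S)
    (hbij : ∀ u : T, Function.Bijective (σ u))
    (hσadd : ∀ (u : T) (a b : S), σ u (BS.add a b) = BS.add (σ u a) (σ u b))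
    (hσmul : ∀ (u : T) (a b : S), σ u (BS.mul a b) = BS.mul (σ u a) (σ u b))
    (hσhom : ∀ (u v : T) (a : S), σ (BT.mul u v) a = σ u (σ v a))
    (δ : S → T → T)
    (hδadd : ∀ (a : S) (u v : T), δ a (BT.add u v) = BT.add (δ a u) (δ a v))
    (𝔟 : S → S → T)
    (hcocycle : ∀ (a b c : S) (u v : T),
      BT.add (BT.add (BT.add (𝔟 (BS.add a b) c) (δ c (𝔟 a b))) (δ c (δ b u))) (δ c v) =
        BT.add (BT.add (BT.add (𝔟 a (BS.add b c)) (δ (BS.add b c) u)) (𝔟 b c)) (δ c v))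
    (hcomp : ∀ (a b c : S) (u v : T),
      BT.add (BT.add (𝔟 (BS.mul a (σ u b)) (BS.lam a (σ u c)))
            (δ (BS.lam a (σ u c)) (BT.mul u v)))
          (BT.mul u (BT.add (𝔟 (σ (BT.inv u) (BS.inv a)) c) (δ c (BT.inv u)))) =
        BT.mul u (BT.add (𝔟 b c) (δ c v)))
    (B : LeftInvSemiBrace (S × T))
    (hadd : ∀ p q : S × T, B.add p q =
      (BS.add p.1 q.1, BT.add (BT.add (𝔟 p.1 q.1) (δ q.1 p.2)) q.2))
    (hmul : ∀ p q : S × T, B.mul p q = (BS.mul p.1 (σ p.2 q.1), BT.mul p.2 q.2)) :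
    ∀ (a b : S) (u v : T),
      B.rmap ((a, u), (b, v)) =
        ((BS.lam a (σ u b),
          BT.mul u (BT.add (BT.add (𝔟 (σ (BT.inv u) (BS.inv a)) b) (δ b (BT.inv u))) v)),
         (σ (BT.mul
              (BT.inv (BT.add (BT.add (𝔟 (σ (BT.inv u) (BS.inv a)) b) (δ b (BT.inv u))) v))
              (BT.inv u))
            (BS.rho (σ u b) a),
          BT.mul
            (BT.inv (BT.add (BT.add (𝔟 (σ (BT.inv u) (BS.inv a)) b) (δ b (BT.inv u))) v))
            v)) := by
  intro a b u v
  have hinj := fun u => (hbij u).injective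
  have h_inv := BS.inv_semidirect BT.toInvSemigroup σ hinj hσhom hσmul B.toInvSemigroup hmul
  have h_map := fun u => BS.map_inv BS.toInvSemigroup (σ u) (hσmul u)
  simp only [LeftInvSemiBrace.rmap, LeftInvSemiBrace.lam, LeftInvSemiBrace.rho, h_inv, hadd, hmul,
    hσadd, hσmul, hσhom, h_map, BT.act_act_inv σ hinj hσhom, BT.act_inv_act σ hinj hσhom]
end
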